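/- arXiv:1511.07712 — 2 statements merged into one kernel-verified Lean document; each statement's English description precedes it below -/
import Mathlib

section
/- The modified Berne interaction potential U is jointly continuous in all of its variables (r, r̄, θ, θ̄) ∈ ℝ² × ℝ² × ℝ × ℝ, is everywhere nonnegative, and has compact support in the relative position: U(r, r̄, θ, θ̄) = 0 whenever |r̄ − r| ≥ √2 · l. -/
open Real Matrix

noncomputable section

/-- The anisotropy parameter λ = (l²−d²)/(l²+d²). -/
def lam (l d : ℝ) : ℝ := (l ^ 2 - d ^ 2) / (l ^ 2 + d ^ 2)

/-- The orientation vector η(θ) = (cos θ, sin θ). -/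
def eta (θ : ℝ) : Fin 2 → ℝ := ![Real.cos θ, Real.sin θ]

/-- The amplitude a(θ,θ̄) = ε₀ (1 − λ² (η(θ)·η(θ̄))²)^{-1/2}. -/
def aAmp (l d ε₀ θ θ' : ℝ) : ℝ :=
  ε₀ / Real.sqrt (1 - (lam l d) ^ 2 * (eta θ ⬝ᵥ eta θ') ^ 2)

/-- The shape matrix γ(θ) = (l²−d²) η(θ)η(θ)ᵀ + d² I. -/
def gam (l d θ : ℝ) : Matrix (Fin 2) (Fin 2) ℝ :=
  (l ^ 2 - d ^ 2) • Matrix.vecMulVec (eta θ) (eta θ) + d ^ 2 • (1 : Matrix (Fin 2) (Fin 2) ℝ)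

/-- The quadratic form Q_{θ,θ̄}(x) = xᵀ (γ(θ)+γ(θ̄))⁻¹ x. -/
def Qform (l d θ θ' : ℝ) (x : Fin 2 → ℝ) : ℝ :=
  x ⬝ᵥ (gam l d θ + gam l d θ')⁻¹ *ᵥ x

/-- The cutoff profile φ(t) = exp(−t/(1−t)) for t < 1, φ(t) = 0 for t ≥ 1. -/
def cutoff (t : ℝ) : ℝ := if t < 1 then Real.exp (-t / (1 - t)) else 0

/-- The modified Berne interaction potential U(r,r̄,θ,θ̄) = a(θ,θ̄) φ(Q_{θ,θ̄}(r̄−r)). -/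
def Upot (l d ε₀ : ℝ) (r r' : Fin 2 → ℝ) (θ θ' : ℝ) : ℝ :=
  aAmp l d ε₀ θ θ' * cutoff (Qform l d θ θ' (r' - r))

theorem cutoff_eq_expNegInvGlue (t : ℝ) : cutoff t = Real.exp 1 * expNegInvGlue (1 - t) := by
  unfold cutoff expNegInvGlue
  by_cases h : t < 1
  · have h1 : 1 - t ≠ 0 := by linarith
    rw [if_pos h, if_neg (by linarith), ← Real.exp_add]
    congr 1
    field_simp
    ring
  · rw [if_neg h, if_pos (by linarith), mul_zero]

theorem continuous_cutoff : Continuous cutoff := by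
  rw [funext cutoff_eq_expNegInvGlue]
  have h : Continuous expNegInvGlue := (expNegInvGlue.contDiff (n := 0)).continuous
  fun_prop

theorem cutoff_nonneg (t : ℝ) : 0 ≤ cutoff t := by
  rw [cutoff_eq_expNegInvGlue]
  exact mul_nonneg (Real.exp_pos 1).le (expNegInvGlue.nonneg _)

theorem continuous_eta : Continuous eta := by
  refine continuous_pi fun i => ?_
  fin_cases i
  · exact Real.continuous_cos
  · exact Real.continuous_sin

theorem continuous_gam (l d : ℝ) : Continuous (gam l d) := by
  have h := continuous_eta
  have hv : Continuous fun θ => Matrix.vecMulVec (eta θ) (eta θ) := h.matrix_vecMulVec h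
  unfold gam
  exact (hv.const_smul (l ^ 2 - d ^ 2)).add continuous_const

theorem eta_dotProduct_eta (θ θ' : ℝ) : eta θ ⬝ᵥ eta θ' = Real.cos (θ - θ') := by
  simp [eta, dotProduct, Fin.sum_univ_two, Real.cos_sub]

theorem one_sub_lam_sq_mul_pos {l d : ℝ} (hd : 0 < d) (hdl : d < l) (θ θ' : ℝ) :
    0 < 1 - (lam l d) ^ 2 * (eta θ ⬝ᵥ eta θ') ^ 2 := by
  have hs : 0 < l ^ 2 + d ^ 2 := by positivity
  have hl : (lam l d) ^ 2 < 1 := by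
    rw [sq_lt_one_iff_abs_lt_one, abs_lt]
    unfold lam
    constructor
    · rw [lt_div_iff₀ hs]
      nlinarith
    · rw [div_lt_one hs]
      nlinarith
  rw [eta_dotProduct_eta]
  nlinarith [Real.cos_sq_le_one (θ - θ'), sq_nonneg (lam l d), sq_nonneg (Real.cos (θ - θ'))]

theorem det_gam_add_gam (l d θ θ' : ℝ) :
    (gam l d θ + gam l d θ').det =
      (l ^ 2 - d ^ 2) ^ 2 * Real.sin (θ - θ') ^ 2 + 4 * l ^ 2 * d ^ 2 := by
  rw [Matrix.det_fin_two, Real.sin_sub]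
  simp [gam, eta]
  have h := Real.sin_sq_add_cos_sq θ
  have h' := Real.sin_sq_add_cos_sq θ'
  linear_combination (2 * d ^ 2 * (l ^ 2 - d ^ 2)) * (h + h')

theorem det_gam_add_gam_pos {l d : ℝ} (hd : 0 < d) (hdl : d < l) (θ θ' : ℝ) :
    0 < (gam l d θ + gam l d θ').det := by
  have hl : 0 < l := hd.trans hdl
  rw [det_gam_add_gam]
  positivity

theorem Qform_eq_div (l d θ θ' : ℝ) (x : Fin 2 → ℝ) :
    Qform l d θ θ' x =
      x ⬝ᵥ (gam l d θ + gam l d θ').adjugate *ᵥ x / (gam l d θ + gam l d θ').det := by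
  rw [Qform, Matrix.inv_def, Ring.inverse_eq_inv', Matrix.smul_mulVec, dotProduct_smul,
    smul_eq_mul, inv_mul_eq_div]

theorem det_mul_dotProduct_le {l d : ℝ} (hdl : d ^ 2 ≤ l ^ 2) (θ θ' : ℝ) (x : Fin 2 → ℝ) :
    (gam l d θ + gam l d θ').det * (x ⬝ᵥ x) ≤
      2 * l ^ 2 * (x ⬝ᵥ (gam l d θ + gam l d θ').adjugate *ᵥ x) := by
  have h := Real.sin_sq_add_cos_sq θ
  have h' := Real.sin_sq_add_cos_sq θ'
  have hA : 0 ≤ l ^ 2 - d ^ 2 := by linarith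
  set u := Real.cos θ * x 1 - Real.sin θ * x 0 with hu
  set v := Real.cos θ' * x 1 - Real.sin θ' * x 0 with hv
  have key : 2 * l ^ 2 * (x ⬝ᵥ (gam l d θ + gam l d θ').adjugate *ᵥ x) -
      (gam l d θ + gam l d θ').det * (x ⬝ᵥ x) =
      (l ^ 2 - d ^ 2) ^ 2 * ((Real.sin θ * u + Real.sin θ' * v) ^ 2 +
        (Real.cos θ * u + Real.cos θ' * v) ^ 2) +
        2 * d ^ 2 * (l ^ 2 - d ^ 2) * (u ^ 2 + v ^ 2) := by
    rw [det_gam_add_gam, Real.sin_sub, Matrix.adjugate_fin_two]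
    simp [gam, eta, dotProduct, Matrix.mulVec, Fin.sum_univ_two]
    rw [hu, hv]
    have hc := eq_sub_of_add_eq' h
    have hc' := eq_sub_of_add_eq' h'
    grind
  have : 0 ≤ 2 * d ^ 2 * (l ^ 2 - d ^ 2) * (u ^ 2 + v ^ 2) := by positivity
  have : 0 ≤ (l ^ 2 - d ^ 2) ^ 2 * ((Real.sin θ * u + Real.sin θ' * v) ^ 2 +
        (Real.cos θ * u + Real.cos θ' * v) ^ 2) := by positivity
  linarith

theorem one_le_Qform {l d : ℝ} (hd : 0 < d) (hdl : d < l) (θ θ' : ℝ) {x : Fin 2 → ℝ}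
    (hx : 2 * l ^ 2 ≤ x ⬝ᵥ x) : 1 ≤ Qform l d θ θ' x := by
  have hD := det_gam_add_gam_pos hd hdl θ θ'
  have hl : 0 < l := hd.trans hdl
  rw [Qform_eq_div, one_le_div hD]
  have h := det_mul_dotProduct_le (pow_le_pow_left₀ hd.le hdl.le 2) θ θ' x
  have h2 := (mul_le_mul_of_nonneg_left hx hD.le).trans h
  rw [mul_comm] at h2
  exact le_of_mul_le_mul_left h2 (by positivity)

theorem continuous_Qform {l d : ℝ} (hd : 0 < d) (hdl : d < l) :
    Continuous fun p : ℝ × ℝ × (Fin 2 → ℝ) => Qform l d p.1 p.2.1 p.2.2 := by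
  have hM : Continuous fun p : ℝ × ℝ × (Fin 2 → ℝ) => gam l d p.1 + gam l d p.2.1 :=
    ((continuous_gam l d).comp continuous_fst).add
      ((continuous_gam l d).comp (continuous_fst.comp continuous_snd))
  have hx : Continuous fun p : ℝ × ℝ × (Fin 2 → ℝ) => p.2.2 := by fun_prop
  simp only [Qform_eq_div]
  exact (hx.dotProduct (hM.matrix_adjugate.matrix_mulVec hx)).div hM.matrix_det
    fun p => (det_gam_add_gam_pos hd hdl p.1 p.2.1).ne'

theorem continuous_aAmp {l d : ℝ} (ε₀ : ℝ) (hd : 0 < d) (hdl : d < l) :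
    Continuous fun p : ℝ × ℝ => aAmp l d ε₀ p.1 p.2 := by
  have hη : Continuous fun p : ℝ × ℝ => eta p.1 ⬝ᵥ eta p.2 :=
    (continuous_eta.comp continuous_fst).dotProduct (continuous_eta.comp continuous_snd)
  unfold aAmp
  exact continuous_const.div
    (Real.continuous_sqrt.comp (continuous_const.sub (continuous_const.mul (hη.pow 2))))
    fun p => (Real.sqrt_pos.2 (one_sub_lam_sq_mul_pos hd hdl p.1 p.2)).ne'

theorem Upot_continuous_nonneg_compact_support
    (l d ε₀ : ℝ) (hd : 0 < d) (hdl : d < l) (hε : 0 < ε₀) :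
    Continuous (fun p : (Fin 2 → ℝ) × (Fin 2 → ℝ) × ℝ × ℝ =>
      Upot l d ε₀ p.1 p.2.1 p.2.2.1 p.2.2.2) ∧
    (∀ (r r' : Fin 2 → ℝ) (θ θ' : ℝ), 0 ≤ Upot l d ε₀ r r' θ θ') ∧
    (∀ (r r' : Fin 2 → ℝ) (θ θ' : ℝ),
      Real.sqrt 2 * l ≤ Real.sqrt ((r' - r) ⬝ᵥ (r' - r)) →
      Upot l d ε₀ r r' θ θ' = 0) := by
  refine ⟨?_, fun r r' θ θ' => ?_, fun r r' θ θ' h => ?_⟩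
  · have ha : Continuous fun p : (Fin 2 → ℝ) × (Fin 2 → ℝ) × ℝ × ℝ =>
        aAmp l d ε₀ p.2.2.1 p.2.2.2 :=
      (continuous_aAmp ε₀ hd hdl).comp (continuous_snd.comp continuous_snd)
    have hq : Continuous fun p : (Fin 2 → ℝ) × (Fin 2 → ℝ) × ℝ × ℝ =>
        Qform l d p.2.2.1 p.2.2.2 (p.2.1 - p.1) :=
      (continuous_Qform hd hdl).comp
        (g := fun p : ℝ × ℝ × (Fin 2 → ℝ) => Qform l d p.1 p.2.1 p.2.2)
        (f := fun p : (Fin 2 → ℝ) × (Fin 2 → ℝ) × ℝ × ℝ => (p.2.2.1, p.2.2.2, p.2.1 - p.1))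
        (by fun_prop)
    exact ha.mul (continuous_cutoff.comp hq)
  · exact mul_nonneg (div_nonneg hε.le (Real.sqrt_nonneg _)) (cutoff_nonneg _)
  · have hl : 0 < l := hd.trans hdl
    have hx : 2 * l ^ 2 ≤ (r' - r) ⬝ᵥ (r' - r) := by
      have h2 := (Real.le_sqrt' (by positivity)).1 h
      rwa [mul_pow, Real.sq_sqrt zero_le_two] at h2
    rw [Upot, cutoff, if_neg (not_lt.2 (one_le_Qform hd hdl θ θ' hx)), mul_zero]
end
end

section
/- Stationary solutions of the Maxwellian-closed hydrodynamic system: let V₁ ∈ C¹(ℝ²), V₂ ∈ C¹(ℝ), let U: ℝ²×ℝ²×ℝ×ℝ → ℝ be C¹, bounded, with bounded first derivatives, and suppose q: ℝ² × ℝ → (0, ∞) is continuous, Lebesgue integrable, and satisfies the fixed-point integral equation q(r, θ) = Z^{-1} exp(−V₁(r) − V₂(θ) − K[q](r, θ)) for some constant Z > 0, where K[q](r, θ) = ∬ U(r, r̄, θ, θ̄) q(r̄, θ̄) dr̄ dθ̄. Then q is continuously differentiable and satisfies ∇_r q = −q (∇_r V₁(r) + ∬ ∇_r U(r, r̄, θ,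 θ̄) q(r̄, θ̄) dr̄ dθ̄) and ∂_θ q = −q (V₂′(θ) + ∬ ∂_θ U(r, r̄, θ, θ̄) q(r̄, θ̄) dr̄ dθ̄). Consequently, the time-independent triple (q, v ≡ 0, ω ≡ 0) is a classical stationary solution of the closed system ∂_t q + ∇_r·(q v) + ∂_θ(q ω) = 0, ∂_t(q v) + ∇_r·(q v⊗v + q I) + ∂_θ(q v ω) = q S₁[q] − (A²/2) q v, ∂_t(q ω) + ∇_r·(q v ω) + ∂_θ(q ω² + q) = q S₂[q] − (B²/2) q ω, where S₁[q] = −∇_r V₁ − ∬ ∇_r U(r, r̄, θ, θ̄) q(r̄, θ̄) dr̄ dθ̄ and S₂[q] = −V₂′(θ) − ∬ ∂_θ U(r, r̄, θ, θ̄) q(r̄, θ̄) dr̄ dθ̄ (the case γ = γ̄ = 0 and m = I_c = 1), for any constants A, B ≥ 0. -/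
open Real MeasureTheory

noncomputable section

/-- Positions in the plane. -/
abbrev Vec2 := Fin 2 → ℝ

/-- Partial derivative of a scalar function on ℝ² in the i-th coordinate direction. -/
def pd (h : Vec2 → ℝ) (r : Vec2) (i : Fin 2) : ℝ := fderiv ℝ h r (Pi.single i 1)

/-- The interaction functional K[q](r,θ) = ∬ U(r,r̄,θ,θ̄) q(r̄,θ̄) dr̄ dθ̄. -/
def Kfun (U : Vec2 → Vec2 → ℝ → ℝ → ℝ) (q : Vec2 → ℝ → ℝ) (r : Vec2) (θ : ℝ) : ℝ :=
  ∫ p : Vec2 × ℝ, U r p.1 θ p.2 * q p.1 p.2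

/-- A parametric integral with a bounded `C¹` kernel against an integrable density can be
differentiated under the integral sign. -/
theorem hasFDerivAt_integral_mul_of_bounded {E Y : Type*} [NormedAddCommGroup E]
    [NormedSpace ℝ E] [TopologicalSpace Y] [SecondCountableTopology Y] [MeasurableSpace Y]
    [OpensMeasurableSpace Y] {μ : Measure Y} {W : E → Y → ℝ} {W' : E → Y → E →L[ℝ] ℝ}
    {g : Y → ℝ} {C C' : ℝ} (hg : Integrable g μ)
    (hW : ∀ x, Continuous (W x)) (hWb : ∀ x y, |W x y| ≤ C)
    (hW' : ∀ x, Continuous (W' x)) (hWb' : ∀ x y, ‖W' x y‖ ≤ C')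
    (hd : ∀ x y, HasFDerivAt (fun x => W x y) (W' x y) x) (x : E) :
    Integrable (fun y => g y • W' x y) μ ∧
      HasFDerivAt (fun x => ∫ y, W x y * g y ∂μ) (∫ y, g y • W' x y ∂μ) x := by
  have hmeas : ∀ x, AEStronglyMeasurable (fun y => g y • W' x y) μ := fun x =>
    hg.aestronglyMeasurable.smul (hW' x).aestronglyMeasurable
  have hbd : ∀ x y, ‖g y • W' x y‖ ≤ C' * ‖g y‖ := fun x y => by
    rw [norm_smul, mul_comm]
    exact mul_le_mul_of_nonneg_right (hWb' x y) (norm_nonneg _)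
  have hb : Integrable (fun y => C' * ‖g y‖) μ := hg.norm.const_mul C'
  refine ⟨hb.mono' (hmeas x) (.of_forall (hbd x)), ?_⟩
  refine hasFDerivAt_integral_of_dominated_of_fderiv_le (F' := fun x y => g y • W' x y)
    (bound := fun y => C' * ‖g y‖) Filter.univ_mem
    (.of_forall fun x => (hW x).aestronglyMeasurable.mul hg.aestronglyMeasurable) ?_ (hmeas x)
    (.of_forall fun y x _ => hbd x y) hb (.of_forall fun y x _ => (hd x y).mul_const (g y))
  exact hg.bdd_mul (hW x).aestronglyMeasurable (.of_forall (hWb x))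

/-- The integral of a jointly continuous bounded kernel against an integrable density depends
continuously on the parameter. -/
theorem continuous_integral_smul_of_bounded {E F Y : Type*} [TopologicalSpace E]
    [FirstCountableTopology E] [NormedAddCommGroup F] [NormedSpace ℝ F]
    [TopologicalSpace Y] [SecondCountableTopology Y] [MeasurableSpace Y]
    [OpensMeasurableSpace Y] {μ : Measure Y} {W : E → Y → F} {g : Y → ℝ} {C : ℝ}
    (hg : Integrable g μ) (hW : Continuous fun p : E × Y => W p.1 p.2)
    (hWb : ∀ x y, ‖W x y‖ ≤ C) : Continuous fun x => ∫ y, g y • W x y ∂μ := by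
  refine continuous_of_dominated (bound := fun y => C * ‖g y‖)
    (fun x => hg.aestronglyMeasurable.smul
      (hW.comp (Continuous.prodMk_right x)).aestronglyMeasurable)
    (fun x => .of_forall fun y => ?_) (hg.norm.const_mul C)
    (.of_forall fun y => (hW.comp (Continuous.prodMk_left y)).const_smul (g y))
  rw [norm_smul, mul_comm]
  exact mul_le_mul_of_nonneg_right (hWb x y) (norm_nonneg _)

/-- The partial derivative of a slice in the position variable. -/
theorem pd_slice {f : Vec2 × ℝ → ℝ} {f' : Vec2 × ℝ →L[ℝ] ℝ} {r : Vec2} {θ : ℝ}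
    (h : HasFDerivAt f f' (r, θ)) (i : Fin 2) :
    pd (fun r' => f (r', θ)) r i = f' (Pi.single i 1, 0) := by
  have h2 := HasFDerivAt.comp (f := fun e => (e, θ)) r h (hasFDerivAt_prodMk_left r θ)
  have h3 : fderiv ℝ (fun r' => f (r', θ)) r = _ := h2.fderiv
  simp [pd, h3]

/-- The derivative of a slice in the angular variable. -/
theorem deriv_slice {f : Vec2 × ℝ → ℝ} {f' : Vec2 × ℝ →L[ℝ] ℝ} {r : Vec2} {θ : ℝ}
    (h : HasFDerivAt f f' (r, θ)) :
    deriv (fun θ' => f (r, θ')) θ = f' (0, 1) := by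
  have h2 := (h.comp θ (hasFDerivAt_prodMk_right r θ)).hasDerivAt
  have h3 : deriv (fun θ' => f (r, θ')) θ = _ := h2.deriv
  simp [h3]

/-- The linear map reordering a pair of states into the argument order of the interaction
potential. -/
def interleave : (Vec2 × ℝ) × (Vec2 × ℝ) →L[ℝ] Vec2 × Vec2 × ℝ × ℝ :=
  ((ContinuousLinearMap.fst ℝ Vec2 ℝ).comp (ContinuousLinearMap.fst ℝ _ _)).prod
    (((ContinuousLinearMap.fst ℝ Vec2 ℝ).comp (ContinuousLinearMap.snd ℝ _ _)).prod
      (((ContinuousLinearMap.snd ℝ Vec2 ℝ).comp (ContinuousLinearMap.fst ℝ _ _)).prod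
        ((ContinuousLinearMap.snd ℝ Vec2 ℝ).comp (ContinuousLinearMap.snd ℝ _ _))))

/-- Stationary solutions of the Maxwellian-closed hydrodynamic system. -/
theorem stationary_solution_maxwellian_closure
    (V1 : Vec2 → ℝ) (V2 : ℝ → ℝ) (U : Vec2 → Vec2 → ℝ → ℝ → ℝ)
    (hV1 : ContDiff ℝ 1 V1) (hV2 : ContDiff ℝ 1 V2)
    (hU : ContDiff ℝ 1 (fun p : Vec2 × Vec2 × ℝ × ℝ => U p.1 p.2.1 p.2.2.1 p.2.2.2))
    (hUb : ∃ C, ∀ (r r' : Vec2) (θ θ' : ℝ), |U r r' θ θ'| ≤ C)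
    (hUd : ∃ C, ∀ p : Vec2 × Vec2 × ℝ × ℝ,
      ‖fderiv ℝ (fun p' : Vec2 × Vec2 × ℝ × ℝ => U p'.1 p'.2.1 p'.2.2.1 p'.2.2.2) p‖ ≤ C)
    (q : Vec2 → ℝ → ℝ)
    (hqpos : ∀ (r : Vec2) (θ : ℝ), 0 < q r θ)
    (hqc : Continuous (fun p : Vec2 × ℝ => q p.1 p.2))
    (hqint : Integrable (fun p : Vec2 × ℝ => q p.1 p.2))
    (Z : ℝ) (hZ : 0 < Z)
    (hfix : ∀ (r : Vec2) (θ : ℝ),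
      q r θ = Z⁻¹ * Real.exp (-V1 r - V2 θ - Kfun U q r θ))
    (A B : ℝ) (hA : 0 ≤ A) (hB : 0 ≤ B) :
    -- q is continuously differentiable
    ContDiff ℝ 1 (fun p : Vec2 × ℝ => q p.1 p.2) ∧
    -- ∇_r q = −q (∇_r V₁ + ∬ ∇_r U q)
    (∀ (r : Vec2) (θ : ℝ) (i : Fin 2),
      pd (fun r' => q r' θ) r i
        = -(q r θ) * (pd V1 r i
            + ∫ p : Vec2 × ℝ, pd (fun r' => U r' p.1 θ p.2) r i * q p.1 p.2)) ∧
    -- ∂_θ q = −q (V₂′ + ∬ ∂_θ U q)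
    (∀ (r : Vec2) (θ : ℝ),
      deriv (fun θ' => q r θ') θ
        = -(q r θ) * (deriv V2 θ
            + ∫ p : Vec2 × ℝ, deriv (fun θ'' => U r p.1 θ'' p.2) θ * q p.1 p.2)) ∧
    -- (q, v ≡ 0, ω ≡ 0) is a classical stationary solution of the closed system
    -- (the case γ = γ̄ = 0, m = I_c = 1):
    (∀ (t : ℝ) (r : Vec2) (θ : ℝ),
      -- continuity equation
      (deriv (fun _s : ℝ => q r θ) t
        + (∑ i : Fin 2, pd (fun r' => q r' θ * (0 : ℝ)) r i)
        + deriv (fun θ' => q r θ' * (0 : ℝ)) θ = 0) ∧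
      -- momentum equation, i-th component (with v ≡ 0, pressure term q I)
      (∀ i : Fin 2,
        deriv (fun _s : ℝ => q r θ * (0 : ℝ)) t
        + (∑ j : Fin 2, pd (fun r' =>
            q r' θ * ((0 : ℝ) * (0 : ℝ)) + (if i = j then q r' θ else 0)) r j)
        + deriv (fun θ' => q r θ' * ((0 : ℝ) * (0 : ℝ))) θ
        = q r θ * (-(pd V1 r i)
            - ∫ p : Vec2 × ℝ, pd (fun r' => U r' p.1 θ p.2) r i * q p.1 p.2)
          - A ^ 2 / 2 * (q r θ * (0 : ℝ))) ∧
      -- angular-momentum equation (with ω ≡ 0, pressure term q)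
      (deriv (fun _s : ℝ => q r θ * (0 : ℝ)) t
        + (∑ j : Fin 2, pd (fun r' => q r' θ * ((0 : ℝ) * (0 : ℝ))) r j)
        + deriv (fun θ' => q r θ' * ((0 : ℝ) * (0 : ℝ)) + q r θ') θ
        = q r θ * (-(deriv V2 θ)
            - ∫ p : Vec2 × ℝ, deriv (fun θ'' => U r p.1 θ'' p.2) θ * q p.1 p.2)
          - B ^ 2 / 2 * (q r θ * (0 : ℝ)))) := by
  obtain ⟨C, hC⟩ := hUb
  obtain ⟨D, hD⟩ := hUd
  set Φ : Vec2 × Vec2 × ℝ × ℝ → ℝ := fun p => U p.1 p.2.1 p.2.2.1 p.2.2.2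
  let W : Vec2 × ℝ → Vec2 × ℝ → ℝ := fun x y => U x.1 y.1 x.2 y.2
  let J : Vec2 × ℝ →L[ℝ] Vec2 × Vec2 × ℝ × ℝ :=
    interleave.comp (ContinuousLinearMap.inl ℝ _ _)
  let W' : Vec2 × ℝ → Vec2 × ℝ → Vec2 × ℝ →L[ℝ] ℝ := fun x y =>
    (fderiv ℝ Φ (interleave (x, y))).comp J
  have hWc : Continuous fun p : (Vec2 × ℝ) × (Vec2 × ℝ) => W p.1 p.2 :=
    hU.continuous.comp interleave.continuous
  have hW'c : Continuous fun p : (Vec2 × ℝ) × (Vec2 × ℝ) => W' p.1 p.2 :=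
    ((hU.continuous_fderiv one_ne_zero).comp interleave.continuous).clm_comp continuous_const
  have hW'b : ∀ x y, ‖W' x y‖ ≤ D * ‖J‖ := fun x y =>
    (ContinuousLinearMap.opNorm_comp_le _ _).trans
      (mul_le_mul_of_nonneg_right (hD _) (norm_nonneg _))
  have hWd : ∀ x y, HasFDerivAt (fun x => W x y) (W' x y) x := fun x y =>
    (hU.differentiable one_ne_zero _).hasFDerivAt.comp x
      (HasFDerivAt.comp (f := fun e => (e, y)) x interleave.hasFDerivAt
        (hasFDerivAt_prodMk_left x y))
  let Q : Vec2 × ℝ → ℝ := fun p => q p.1 p.2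
  let K' : Vec2 × ℝ → Vec2 × ℝ →L[ℝ] ℝ := fun x => ∫ y, Q y • W' x y
  have hK : ∀ x, Integrable (fun y => Q y • W' x y) ∧
      HasFDerivAt (fun x : Vec2 × ℝ => Kfun U q x.1 x.2) (K' x) x :=
    hasFDerivAt_integral_mul_of_bounded (W := W) hqint
      (fun x => hWc.comp (Continuous.prodMk_right x)) (fun x y => hC _ _ _ _)
      (fun x => hW'c.comp (Continuous.prodMk_right x)) hW'b hWd
  have hK'c : Continuous K' := continuous_integral_smul_of_bounded hqint hW'c hW'b
  have hK1 : ContDiff ℝ 1 fun x : Vec2 × ℝ => Kfun U q x.1 x.2 := by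
    refine contDiff_one_iff_fderiv.2 ⟨fun x => (hK x).2.differentiableAt, ?_⟩
    rwa [funext fun x => (hK x).2.fderiv]
  have hQ : Q = fun x => Z⁻¹ * Real.exp (-V1 x.1 - V2 x.2 - Kfun U q x.1 x.2) :=
    funext fun x => hfix x.1 x.2
  have hQ1 : ContDiff ℝ 1 Q := by
    rw [hQ]
    exact contDiff_const.mul
      ((((hV1.comp contDiff_fst).neg.sub (hV2.comp contDiff_snd)).sub hK1).exp)
  have hV1d : ∀ x : Vec2 × ℝ, HasFDerivAt (fun x : Vec2 × ℝ => V1 x.1)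
      ((fderiv ℝ V1 x.1).comp (ContinuousLinearMap.fst ℝ _ _)) x := fun x =>
    (hV1.differentiable one_ne_zero _).hasFDerivAt.comp x hasFDerivAt_fst
  have hV2d : ∀ x : Vec2 × ℝ, HasFDerivAt (fun x : Vec2 × ℝ => V2 x.2)
      ((fderiv ℝ V2 x.2).comp (ContinuousLinearMap.snd ℝ _ _)) x := fun x =>
    (hV2.differentiable one_ne_zero _).hasFDerivAt.comp x hasFDerivAt_snd
  have hQd : ∀ x, HasFDerivAt Q (Q x • (-(fderiv ℝ V1 x.1).comp (ContinuousLinearMap.fst ℝ Vec2 ℝ)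
      - (fderiv ℝ V2 x.2).comp (ContinuousLinearMap.snd ℝ Vec2 ℝ) - K' x)) x := fun x => by
    have h := ((((hV1d x).neg.sub (hV2d x)).sub (hK x).2).exp).const_mul Z⁻¹
    rw [smul_smul] at h
    rw [show Q x = _ from congrFun hQ x, hQ]
    exact h
  have hr : ∀ (r : Vec2) (θ : ℝ) (i : Fin 2),
      pd (fun r' => q r' θ) r i
        = -(q r θ) * (pd V1 r i
            + ∫ p : Vec2 × ℝ, pd (fun r' => U r' p.1 θ p.2) r i * q p.1 p.2) := by
    intro r θ i
    have hI : K' (r, θ) (Pi.single i 1, 0)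
        = ∫ p : Vec2 × ℝ, pd (fun r' => U r' p.1 θ p.2) r i * q p.1 p.2 := by
      rw [ContinuousLinearMap.integral_apply (hK _).1]
      refine integral_congr_ae (.of_forall fun p => ?_)
      have h := pd_slice (hWd (r, θ) p) i
      change q p.1 p.2 * W' (r, θ) p (Pi.single i 1, 0) = pd (fun r' => W (r', θ) p) r i * _
      rw [h, mul_comm]
    rw [← hI]
    refine (pd_slice (hQd (r, θ)) i).trans ?_
    simp [Q, pd]
    ring
  have hθ : ∀ (r : Vec2) (θ : ℝ),
      deriv (fun θ' => q r θ') θ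
        = -(q r θ) * (deriv V2 θ
            + ∫ p : Vec2 × ℝ, deriv (fun θ'' => U r p.1 θ'' p.2) θ * q p.1 p.2) := by
    intro r θ
    have hI : K' (r, θ) (0, 1)
        = ∫ p : Vec2 × ℝ, deriv (fun θ'' => U r p.1 θ'' p.2) θ * q p.1 p.2 := by
      rw [ContinuousLinearMap.integral_apply (hK _).1]
      refine integral_congr_ae (.of_forall fun p => ?_)
      have h := deriv_slice (hWd (r, θ) p)
      change q p.1 p.2 * W' (r, θ) p (0, 1) = deriv (fun θ' => W (r, θ') p) θ * _
      rw [h, mul_comm]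
    rw [← hI]
    refine (deriv_slice (hQd (r, θ))).trans ?_
    simp [Q]
    ring
  have hpd0 : ∀ (r : Vec2) (i : Fin 2), pd (fun _ => 0) r i = 0 := fun r i => by simp [pd]
  refine ⟨hQ1, hr, hθ, fun t r θ => ⟨?_, fun i => ?_, ?_⟩⟩
  · simp [hpd0]
  · have hsum : (∑ j : Fin 2, pd (fun r' =>
        q r' θ * ((0 : ℝ) * (0 : ℝ)) + (if i = j then q r' θ else 0)) r j)
        = pd (fun r' => q r' θ) r i := by
      rw [Finset.sum_eq_single i (fun j _ hj => by simp [hj.symm, hpd0]) (by simp)]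
      simp
    rw [hsum, hr]
    simp only [mul_zero, deriv_const]
    ring
  · simp only [mul_zero, zero_add, deriv_const, hpd0, Finset.sum_const_zero, hθ]
    ring
end
end
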